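/- Let n ≥ 2 and let k be a nonzero integer. Both posets ([1,λ^k], ⪯) and ([1,λ^k]_r, ⪯_r) are lattices: any two elements of [1,λ^k] have a least upper bound and a greatest lower bound in [1,λ^k] with respect to ⪯, and likewise for [1,λ^k]_r with respect to ⪯_r. -/

import Mathlib

/-- The indeterminate `x` in the field `K = ℚ(x)` of rational functions over `ℚ`. -/
noncomputable def xx : RatFunc ℚ := RatFunc.X

/-- Membership in `G(∞,∞,n)`: a monomial matrix whose nonzero entries are integer powers
of `x` and such that the product of the nonzero entries is `1`. -/
def IsGinf (n : ℕ) (w : Matrix (Fin n) (Fin n) (RatFunc ℚ)) : Prop :=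
  (∀ i : Fin n, ∃! c : Fin n, w i c ≠ 0) ∧
  (∀ c : Fin n, ∃! i : Fin n, w i c ≠ 0) ∧
  (∀ i c : Fin n, w i c ≠ 0 → ∃ k : ℤ, w i c = xx ^ k) ∧
  (∏ i : Fin n, ∑ c : Fin n, w i c) = 1

/-- The generator `t_i` (1-indexed rows/columns 1,2 are `Fin` indices 0,1). -/
noncomputable def tMat (n : ℕ) (i : ℤ) : Matrix (Fin n) (Fin n) (RatFunc ℚ) :=
  fun r c =>
    if r.val = 0 ∧ c.val = 1 then xx ^ (-i)
    else if r.val = 1 ∧ c.val = 0 then xx ^ i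
    else if r = c ∧ 2 ≤ r.val then 1 else 0

/-- The generator `s_j` (`3 ≤ j ≤ n`): permutation matrix of the transposition exchanging
coordinates `j-1` and `j` (1-indexed), i.e. `Fin` indices `j-2` and `j-1`. -/
noncomputable def sMat (n : ℕ) (j : ℕ) : Matrix (Fin n) (Fin n) (RatFunc ℚ) :=
  fun r c =>
    if (r.val + 2 = j ∧ c.val + 1 = j) ∨ (r.val + 1 = j ∧ c.val + 2 = j) ∨
       (r = c ∧ r.val + 2 ≠ j ∧ r.val + 1 ≠ j) then 1 else 0

/-- The generating set `X = {t_i : i ∈ ℤ} ∪ {s_j : 3 ≤ j ≤ n}`. -/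
def Xset (n : ℕ) : Set (Matrix (Fin n) (Fin n) (RatFunc ℚ)) :=
  {w | (∃ i : ℤ, w = tMat n i) ∨ (∃ j : ℕ, 3 ≤ j ∧ j ≤ n ∧ w = sMat n j)}

/-- `len n w` is the minimal `m` such that `w` is a product of `m` elements of `X`. -/
noncomputable def len (n : ℕ) (w : Matrix (Fin n) (Fin n) (RatFunc ℚ)) : ℕ :=
  sInf {m | ∃ L : List (Matrix (Fin n) (Fin n) (RatFunc ℚ)),
    L.length = m ∧ (∀ a ∈ L, a ∈ Xset n) ∧ L.prod = w}

/-- Left divisibility: `v ⪯ w` iff `ℓ(v) + ℓ(v⁻¹ w) = ℓ(w)`. -/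
def preL (n : ℕ) (v w : Matrix (Fin n) (Fin n) (RatFunc ℚ)) : Prop :=
  len n v + len n (v⁻¹ * w) = len n w

/-- Right divisibility: `v ⪯_r w` iff `ℓ(w v⁻¹) + ℓ(v) = ℓ(w)`. -/
def preR (n : ℕ) (v w : Matrix (Fin n) (Fin n) (RatFunc ℚ)) : Prop :=
  len n (w * v⁻¹) + len n v = len n w

/-- The element `λ = diag(x^{-(n-1)}, x, …, x)`. -/
noncomputable def lam (n : ℕ) : Matrix (Fin n) (Fin n) (RatFunc ℚ) :=
  Matrix.diagonal (fun i => if i.val = 0 then xx ^ (-((n : ℤ) - 1)) else xx)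

/-- The interval `[1, λ^k]` of left divisors of `λ^k`. -/
noncomputable def intervalL (n : ℕ) (k : ℤ) : Set (Matrix (Fin n) (Fin n) (RatFunc ℚ)) :=
  {v | preL n v ((lam n) ^ k)}

/-- The interval `[1, λ^k]_r` of right divisors of `λ^k`. -/
noncomputable def intervalR (n : ℕ) (k : ℤ) : Set (Matrix (Fin n) (Fin n) (RatFunc ℚ)) :=
  {v | preR n v ((lam n) ^ k)}

/-- `m` is a least upper bound of `u` and `v` in the poset `([1,λ^k], ⪯)`. -/
noncomputable def IsLubL (n : ℕ) (k : ℤ)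
    (u v m : Matrix (Fin n) (Fin n) (RatFunc ℚ)) : Prop :=
  m ∈ intervalL n k ∧ preL n u m ∧ preL n v m ∧
    ∀ z ∈ intervalL n k, preL n u z → preL n v z → preL n m z

/-- `m` is a least upper bound of `u` and `v` in the poset `([1,λ^k]_r, ⪯_r)`. -/
noncomputable def IsLubR (n : ℕ) (k : ℤ)
    (u v m : Matrix (Fin n) (Fin n) (RatFunc ℚ)) : Prop :=
  m ∈ intervalR n k ∧ preR n u m ∧ preR n v m ∧
    ∀ z ∈ intervalR n k, preR n u z → preR n v z → preR n m z

section PrefixOrder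

variable {G : Type*} [Group G]

/-- The prefix relation of a length function on a group. -/
def PrefixLE (ℓ : G → ℕ) (u w : G) : Prop := ℓ u + ℓ (u⁻¹ * w) = ℓ w

variable {ℓ : G → ℕ}

theorem PrefixLE.trans (hmul : ∀ u v, ℓ (u * v) ≤ ℓ u + ℓ v) {u v w : G}
    (huv : PrefixLE ℓ u v) (hvw : PrefixLE ℓ v w) : PrefixLE ℓ u w := by
  unfold PrefixLE at *
  have h₁ := hmul (u⁻¹ * v) (v⁻¹ * w)
  have h₂ := hmul u (u⁻¹ * w)
  rw [show u⁻¹ * v * (v⁻¹ * w) = u⁻¹ * w by group] at h₁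
  rw [show u * (u⁻¹ * w) = w by group] at h₂
  omega

theorem PrefixLE.mul_left_mul (hmul : ∀ u v, ℓ (u * v) ≤ ℓ u + ℓ v) {z w m : G}
    (hz : PrefixLE ℓ z w) (hm : PrefixLE ℓ m (z⁻¹ * w)) :
    PrefixLE ℓ z (z * m) ∧ PrefixLE ℓ (z * m) w := by
  unfold PrefixLE at *
  have h₁ := hmul z m
  have h₂ := hmul (z * m) ((z * m)⁻¹ * w)
  rw [show z * m * ((z * m)⁻¹ * w) = w by group] at h₂
  rw [show m⁻¹ * (z⁻¹ * w) = (z * m)⁻¹ * w by group] at hm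
  rw [show z⁻¹ * (z * m) = m by group]
  omega

theorem PrefixLE.of_mul_left (hmul : ∀ u v, ℓ (u * v) ≤ ℓ u + ℓ v) {z w g : G}
    (hz : PrefixLE ℓ z (z * g)) (hg : PrefixLE ℓ (z * g) w) : PrefixLE ℓ g (z⁻¹ * w) := by
  have h := hz.trans hmul hg
  unfold PrefixLE at *
  rw [show z⁻¹ * (z * g) = g by group] at hz
  rw [show g⁻¹ * (z⁻¹ * w) = (z * g)⁻¹ * w by group]
  omega

/-- If every element other than `1` has an atom of `S` as a prefix, if the prefixes of `Δ` are
also its suffixes, and if pairs of atoms of `S` have least common upper bounds below `Δ`, then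
binary joins exist in the interval `[1, Δ]`. -/
theorem PrefixLE.exists_join (hmul : ∀ u v, ℓ (u * v) ≤ ℓ u + ℓ v) (hone : ℓ 1 = 0)
    {S : Set G} (hS : ∀ w, w ≠ 1 → ∃ g ∈ S, ℓ g = 1 ∧ PrefixLE ℓ g w) {Δ : G}
    (hbal : ∀ v, PrefixLE ℓ v Δ → PrefixLE ℓ (v⁻¹ * Δ) Δ)
    (hloc : ∀ g ∈ S, ∀ h ∈ S, ∃ m, ∀ y, PrefixLE ℓ y Δ → PrefixLE ℓ g y → PrefixLE ℓ h y →
      PrefixLE ℓ g m ∧ PrefixLE ℓ h m ∧ PrefixLE ℓ m y) {a b : G}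
    (ha : PrefixLE ℓ a Δ) (hb : PrefixLE ℓ b Δ) :
    ∃ m, PrefixLE ℓ m Δ ∧ PrefixLE ℓ a m ∧ PrefixLE ℓ b m ∧
      ∀ w, PrefixLE ℓ w Δ → PrefixLE ℓ a w → PrefixLE ℓ b w → PrefixLE ℓ m w := by
  have refl : ∀ u, PrefixLE ℓ u u := fun u => by simp [PrefixLE, hone]
  have hsub : ∀ {z w}, PrefixLE ℓ z w → PrefixLE ℓ w Δ → PrefixLE ℓ (z⁻¹ * w) Δ := by
    intro z w hzw hw
    have hz := hzw.trans hmul hw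
    refine PrefixLE.trans hmul ?_ (hbal z hz)
    exact PrefixLE.of_mul_left hmul (by simpa using hzw) (by simpa using hw)
  have key : ∀ d : ℕ, ∀ z a b, ℓ Δ ≤ ℓ z + d → PrefixLE ℓ z a → PrefixLE ℓ z b →
      PrefixLE ℓ a Δ → PrefixLE ℓ b Δ → ∃ m, PrefixLE ℓ m Δ ∧ PrefixLE ℓ a m ∧ PrefixLE ℓ b m ∧
      ∀ w, PrefixLE ℓ w Δ → PrefixLE ℓ a w → PrefixLE ℓ b w → PrefixLE ℓ m w := by
    intro d
    induction d with
    | zero =>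
      intro z a b hd hza hzb ha hb
      have hzero : ∀ w, ℓ w = 0 → w = 1 := by
        intro w hw
        by_contra hne
        obtain ⟨g, -, hg, hgw⟩ := hS w hne
        unfold PrefixLE at hgw
        omega
      have hza' : z⁻¹ * a = 1 := hzero _ (by unfold PrefixLE at *; omega)
      have hzb' : z⁻¹ * b = 1 := hzero _ (by unfold PrefixLE at *; omega)
      obtain rfl := inv_mul_eq_one.mp hza'
      obtain rfl := inv_mul_eq_one.mp hzb'
      exact ⟨z, ha, refl _, refl _, fun w _ h _ => h⟩
    | succ d ih =>
      intro z a b hd hza hzb ha hb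
      by_cases hae : z = a
      · subst hae
        exact ⟨b, hb, hzb, refl _, fun w _ _ h => h⟩
      by_cases hbe : z = b
      · subst hbe
        exact ⟨a, ha, refl _, hza, fun w _ h _ => h⟩
      obtain ⟨g, hgS, hg1, hga⟩ := hS (z⁻¹ * a) (fun h => hae (inv_mul_eq_one.mp h))
      obtain ⟨h, hhS, hh1, hhb⟩ := hS (z⁻¹ * b) (fun h => hbe (inv_mul_eq_one.mp h))
      obtain ⟨hzg, hzga⟩ := PrefixLE.mul_left_mul hmul hza hga
      obtain ⟨hzh, hzhb⟩ := PrefixLE.mul_left_mul hmul hzb hhb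
      obtain ⟨m, hm⟩ := hloc g hgS h hhS
      have hup : ∀ w, PrefixLE ℓ w Δ → PrefixLE ℓ (z * g) w → PrefixLE ℓ (z * h) w →
          PrefixLE ℓ (z * g) (z * m) ∧ PrefixLE ℓ (z * h) (z * m) ∧ PrefixLE ℓ (z * m) w := by
        intro w hw hgw hhw
        have hzw := hzg.trans hmul hgw
        obtain ⟨h₁, h₂, h₃⟩ := hm _ (hsub hzw hw) (PrefixLE.of_mul_left hmul hzg hgw)
          (PrefixLE.of_mul_left hmul hzh hhw)
        obtain ⟨h₄, h₅⟩ := PrefixLE.mul_left_mul hmul hzw h₃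
        exact ⟨(PrefixLE.mul_left_mul hmul h₄ (by simpa using h₁)).2,
          (PrefixLE.mul_left_mul hmul h₄ (by simpa using h₂)).2, h₅⟩
      obtain ⟨hgm, hhm, hmΔ⟩ := hup Δ (refl _) (hzga.trans hmul ha) (hzhb.trans hmul hb)
      have hlg : ℓ Δ ≤ ℓ (z * g) + d := by
        unfold PrefixLE at hzg
        rw [show z⁻¹ * (z * g) = g by group] at hzg
        omega
      have hlh : ℓ Δ ≤ ℓ (z * h) + d := by
        unfold PrefixLE at hzh
        rw [show z⁻¹ * (z * h) = h by group] at hzh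
        omega
      obtain ⟨c, hcΔ, hac, hmc, hc⟩ := ih (z * g) a (z * m) hlg hzga hgm ha hmΔ
      obtain ⟨e, heΔ, hce, hbe, he⟩ := ih (z * h) c b hlh (hhm.trans hmul hmc) hzhb hcΔ hb
      refine ⟨e, heΔ, hac.trans hmul hce, hbe, fun w hw haw hbw => ?_⟩
      exact he w hw (hc w hw haw
        (hup w hw (hzga.trans hmul haw) (hzhb.trans hmul hbw)).2.2) hbw
  exact key (ℓ Δ) 1 a b (by omega) (by simp [PrefixLE, hone]) (by simp [PrefixLE, hone]) ha hb

/-- In a graded interval, binary joins yield binary meets. -/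
theorem PrefixLE.exists_meet (hmul : ∀ u v, ℓ (u * v) ≤ ℓ u + ℓ v) (hone : ℓ 1 = 0)
    (hzero : ∀ w, ℓ w = 0 → w = 1) {Δ : G}
    (hjoin : ∀ a b, PrefixLE ℓ a Δ → PrefixLE ℓ b Δ →
      ∃ m, PrefixLE ℓ m Δ ∧ PrefixLE ℓ a m ∧ PrefixLE ℓ b m ∧
        ∀ w, PrefixLE ℓ w Δ → PrefixLE ℓ a w → PrefixLE ℓ b w → PrefixLE ℓ m w) {a b : G}
    (ha : PrefixLE ℓ a Δ) (hb : PrefixLE ℓ b Δ) :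
    ∃ m, PrefixLE ℓ m Δ ∧ PrefixLE ℓ m a ∧ PrefixLE ℓ m b ∧
      ∀ w, PrefixLE ℓ w Δ → PrefixLE ℓ w a → PrefixLE ℓ w b → PrefixLE ℓ w m := by
  obtain ⟨g, ⟨hga, hgb⟩, hmin⟩ := (measure fun g => ℓ Δ - ℓ g).wf.has_min
    {g | PrefixLE ℓ g a ∧ PrefixLE ℓ g b}
    ⟨1, by simp [PrefixLE, hone], by simp [PrefixLE, hone]⟩
  refine ⟨g, hga.trans hmul ha, hga, hgb, fun w hw hwa hwb => ?_⟩
  obtain ⟨j, hjΔ, hgj, hwj, hj⟩ := hjoin g w (hga.trans hmul ha) hw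
  have hle := hmin j ⟨hj a ha hga hwa, hj b hb hgb hwb⟩
  change ¬ (ℓ Δ - ℓ j < ℓ Δ - ℓ g) at hle
  have hgj' : g⁻¹ * j = 1 := hzero _ (by unfold PrefixLE at *; omega)
  obtain rfl := inv_mul_eq_one.mp hgj'
  exact hwj

end PrefixOrder

/-- An element of `G(∞,∞,n)`: the nonzero entry of row `i` is `x ^ exp i`, in column `perm i`. -/
@[ext]
structure Mono (n : ℕ) where
  perm : Equiv.Perm (Fin n)
  exp : Fin n → ℤ
  sum_exp : ∑ i, exp i = 0

namespace Mono

variable {n : ℕ}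

instance : One (Mono n) := ⟨⟨1, 0, by simp⟩⟩

instance : Mul (Mono n) :=
  ⟨fun w v => ⟨v.perm * w.perm, fun i => w.exp i + v.exp (w.perm i), by
    rw [Finset.sum_add_distrib, w.sum_exp, Equiv.sum_comp w.perm v.exp, v.sum_exp, add_zero]⟩⟩

instance : Inv (Mono n) :=
  ⟨fun w => ⟨w.perm.symm, fun c => -w.exp (w.perm.symm c), by
    rw [Finset.sum_neg_distrib, Equiv.sum_comp w.perm.symm w.exp, w.sum_exp, neg_zero]⟩⟩

@[simp] theorem one_perm : (1 : Mono n).perm = 1 := rfl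
@[simp] theorem one_exp : (1 : Mono n).exp = 0 := rfl
@[simp] theorem mul_perm (w v : Mono n) : (w * v).perm = v.perm * w.perm := rfl
@[simp] theorem mul_exp (w v : Mono n) (i : Fin n) :
    (w * v).exp i = w.exp i + v.exp (w.perm i) := rfl
@[simp] theorem inv_perm (w : Mono n) : w⁻¹.perm = w.perm.symm := rfl
@[simp] theorem inv_exp (w : Mono n) (c : Fin n) : w⁻¹.exp c = -w.exp (w.perm.symm c) := rfl

instance : Group (Mono n) :=
  Group.ofLeftAxioms
    (fun a b c => by
      ext i
      · simp
      · simp [add_assoc])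
    (fun a => by ext i <;> simp)
    (fun a => by ext i <;> simp)

/-- The monomial matrix with rows and columns `c`, `d` exchanged and entries `x ^ (-i)`, `x ^ i`
in rows `c`, `d`. -/
def gen (c d : Fin n) (i : ℤ) : Mono n :=
  ⟨Equiv.swap c d, fun r => (if r = d then i else 0) - (if r = c then i else 0), by simp⟩

@[simp] theorem gen_perm (c d : Fin n) (i : ℤ) : (gen c d i).perm = Equiv.swap c d := rfl
@[simp] theorem gen_exp (c d : Fin n) (i : ℤ) (r : Fin n) :
    (gen c d i).exp r = (if r = d then i else 0) - (if r = c then i else 0) := rfl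

/-- The generators `t_i` (`c = 0`) and `s_j` (`i = 0`). -/
def gens (n : ℕ) : Set (Mono n) :=
  {g | ∃ (c d : Fin n) (i : ℤ), d.val = c.val + 1 ∧ (c.val = 0 ∨ i = 0) ∧ g = gen c d i}

theorem gen_mul_self (c d : Fin n) (i : ℤ) : gen c d i * gen c d i = 1 := by
  ext r
  · simp
  · by_cases h : c = d
    · subst h; simp
    · simp only [mul_exp, gen_exp, gen_perm, one_exp, Pi.zero_apply, Equiv.swap_apply_def]
      split_ifs <;> simp_all

/-- The contribution to the length of two nonzero entries in columns `P`, `Q`, the lower of which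
is `x ^ e` in column `Q`. -/
def entryVal (P Q : Fin n) (e : ℤ) : ℕ :=
  if e = 0 then (if Q < P then 1 else 0) else (if P < Q then 2 else 1)

/-- The contribution of a pair of rows `j < i` to the length. -/
def pairVal (w : Mono n) (j i : Fin n) : ℕ := entryVal (w.perm j) (w.perm i) (w.exp i)

/-- The pairs of rows `(j, i)` with `j < i`. -/
def rowPairs (n : ℕ) : Finset (Fin n × Fin n) := Finset.univ.filter fun x => x.1 < x.2

/-- The combinatorial length. -/
def leng (w : Mono n) : ℕ := ∑ x ∈ rowPairs n, w.pairVal x.1 x.2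

theorem leng_one : leng (1 : Mono n) = 0 := by
  refine Finset.sum_eq_zero fun x hx => ?_
  have : x.1 < x.2 := by simpa [rowPairs] using hx
  simp [pairVal, entryVal, this.asymm]

theorem entryVal_swap {c d P Q : Fin n} {i : ℤ} (e : ℤ) (hd : d.val = c.val + 1)
    (hi : c.val = 0 ∨ i = 0) (h₁ : ¬ (P = c ∧ Q = d)) (h₂ : ¬ (P = d ∧ Q = c)) (hne : P ≠ Q) :
    entryVal (Equiv.swap c d P) (Equiv.swap c d Q) (e + (gen c d i).exp Q) = entryVal P Q e := by
  simp only [entryVal, gen_exp, Equiv.swap_apply_def]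
  simp only [Fin.ext_iff, Fin.lt_def, ne_eq] at *
  rcases hi with hi | rfl
  · split_ifs <;> simp_all <;> omega
  · simp only [ite_self, sub_zero, add_zero]
    split_ifs <;> simp_all <;> omega

theorem pairVal_mul_gen_of_ne (w : Mono n) {c d : Fin n} {i : ℤ} (hd : d.val = c.val + 1)
    (hi : c.val = 0 ∨ i = 0) {p q : Fin n}
    (h₁ : ¬ (w.perm p = c ∧ w.perm q = d)) (h₂ : ¬ (w.perm p = d ∧ w.perm q = c)) (hpq : p ≠ q) :
    (w * gen c d i).pairVal p q = w.pairVal p q :=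
  entryVal_swap _ hd hi h₁ h₂ fun h => hpq (w.perm.injective h)

theorem exists_leng_mul_gen (w : Mono n) {c d : Fin n} {i : ℤ} (hd : d.val = c.val + 1)
    (hi : c.val = 0 ∨ i = 0) {p q : Fin n} (hpq : p < q)
    (h : (w.perm p = c ∧ w.perm q = d) ∨ (w.perm p = d ∧ w.perm q = c)) :
    ∃ R, leng w = w.pairVal p q + R ∧
      leng (w * gen c d i) = (w * gen c d i).pairVal p q + R := by
  have hmem : (p, q) ∈ rowPairs n := by simpa [rowPairs] using hpq
  refine ⟨∑ x ∈ (rowPairs n).erase (p, q), w.pairVal x.1 x.2, ?_, ?_⟩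
  · exact (Finset.add_sum_erase _ (fun x => w.pairVal x.1 x.2) hmem).symm
  · unfold leng
    rw [← Finset.add_sum_erase _ _ hmem]
    congr 1
    refine Finset.sum_congr rfl fun x hx => ?_
    obtain ⟨hx, hx'⟩ := Finset.mem_erase.mp hx
    have hlt : x.1 < x.2 := by simpa [rowPairs] using hx'
    have hinj : ∀ a b, w.perm a = w.perm b → a = b := fun a b => (w.perm.injective.eq_iff).mp
    have hx'' : ¬ (x.1 = p ∧ x.2 = q) := fun hc => hx (Prod.ext hc.1 hc.2)
    refine pairVal_mul_gen_of_ne w hd hi ?_ ?_ hlt.ne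
    · rintro ⟨h₁, h₂⟩
      rcases h with ⟨h₃, h₄⟩ | ⟨h₃, h₄⟩
      · exact hx'' ⟨hinj _ _ (h₁.trans h₃.symm), hinj _ _ (h₂.trans h₄.symm)⟩
      · rw [← hinj _ _ (h₁.trans h₄.symm), ← hinj _ _ (h₂.trans h₃.symm)] at hpq
        exact absurd hpq hlt.asymm
    · rintro ⟨h₁, h₂⟩
      rcases h with ⟨h₃, h₄⟩ | ⟨h₃, h₄⟩
      · rw [← hinj _ _ (h₁.trans h₄.symm), ← hinj _ _ (h₂.trans h₃.symm)] at hpq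
        exact absurd hpq hlt.asymm
      · exact hx'' ⟨hinj _ _ (h₁.trans h₃.symm), hinj _ _ (h₂.trans h₄.symm)⟩

/-- `gen c d i` is a right descent of `w`. -/
def Desc (w : Mono n) (c d : Fin n) (i : ℤ) : Prop :=
  (w.perm.symm c < w.perm.symm d ∧ w.exp (w.perm.symm d) ≠ 0) ∨
    (w.perm.symm d < w.perm.symm c ∧ w.exp (w.perm.symm c) = i)

theorem leng_mul_gen (w : Mono n) {c d : Fin n} {i : ℤ} (hd : d.val = c.val + 1)
    (hi : c.val = 0 ∨ i = 0) :
    (Desc w c d i ∧ leng (w * gen c d i) + 1 = leng w) ∨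
      (¬ Desc w c d i ∧ leng (w * gen c d i) = leng w + 1) := by
  have hcd : c < d := by rw [Fin.lt_def]; omega
  unfold Desc
  have hc : w.perm (w.perm.symm c) = c := w.perm.apply_symm_apply c
  have hd' : w.perm (w.perm.symm d) = d := w.perm.apply_symm_apply d
  revert hc hd'
  generalize w.perm.symm c = r
  generalize w.perm.symm d = s
  intro hr hs
  rcases lt_trichotomy r s with h | h | h
  · obtain ⟨R, h₁, h₂⟩ := exists_leng_mul_gen w hd hi h (.inl ⟨hr, hs⟩)
    rw [h₁, h₂]
    by_cases he : w.exp s = 0 <;>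
      simp [pairVal, entryVal, hr, hs, hcd, hcd.ne', hcd.asymm, h, h.asymm, he] <;> omega
  · exact absurd (hr.symm.trans ((congrArg w.perm h).trans hs)) hcd.ne
  · obtain ⟨R, h₁, h₂⟩ := exists_leng_mul_gen w hd hi h (.inr ⟨hs, hr⟩)
    rw [h₁, h₂]
    by_cases he : w.exp r = i
    · subst he
      simp [pairVal, entryVal, hr, hs, hcd, hcd.ne, hcd.asymm, h, h.asymm]
      omega
    · have : w.exp r + -i ≠ 0 := fun h => he (by omega)
      simp [pairVal, entryVal, hr, hs, hcd, hcd.ne, hcd.asymm, h, h.asymm, he, this]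
      omega

theorem eq_one_of_forall_not_desc (w : Mono n)
    (H : ∀ (c d : Fin n) (i : ℤ), d.val = c.val + 1 → (c.val = 0 ∨ i = 0) → ¬ Desc w c d i) :
    w = 1 := by
  have key : ∀ (m : ℕ) (c d : Fin n), c.val = m → d.val = c.val + 1 →
      w.perm.symm c < w.perm.symm d ∧ w.exp (w.perm.symm d) = 0 := by
    have hne : ∀ c d : Fin n, d.val = c.val + 1 → ¬ w.perm.symm d < w.perm.symm c →
        w.perm.symm c < w.perm.symm d := by
      intro c d hd h
      refine lt_of_le_of_ne (not_lt.mp h) fun h' => ?_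
      have := w.perm.symm.injective h'
      subst this
      omega
    intro m
    induction m with
    | zero =>
      intro c d hc hd
      have hlt := hne c d hd fun h => H c d _ hd (.inl hc) (.inr ⟨h, rfl⟩)
      exact ⟨hlt, by_contra fun h => H c d 0 hd (.inl hc) (.inl ⟨hlt, h⟩)⟩
    | succ m ih =>
      intro c d hc hd
      have hc0 := (ih ⟨m, by omega⟩ c rfl hc).2
      have hlt := hne c d hd fun h => H c d 0 hd (.inr rfl) (.inr ⟨h, hc0⟩)
      exact ⟨hlt, by_contra fun h => H c d 0 hd (.inr rfl) (.inl ⟨hlt, h⟩)⟩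
  cases n with
  | zero => ext i <;> exact i.elim0
  | succ n =>
    have hmono : StrictMono w.perm.symm :=
      Fin.strictMono_iff_lt_succ.mpr fun i => (key _ i.castSucc i.succ rfl (by simp)).1
    have hid : ∀ i, w.perm.symm i = i := by
      intro i
      have : hmono.orderIsoOfSurjective _ w.perm.symm.surjective = OrderIso.refl _ :=
        Subsingleton.elim _ _
      exact congrArg (fun f : Fin (n + 1) ≃o Fin (n + 1) => f i) this
    have hs : ∀ i : Fin n, w.exp i.succ = 0 := by
      intro i
      have := (key _ i.castSucc i.succ rfl (by simp)).2
      rwa [hid] at this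
    have h0 : w.exp 0 = 0 := by
      have := w.sum_exp
      rw [Fin.sum_univ_succ] at this
      simpa [hs] using this
    ext i
    · rw [← w.perm.symm_apply_eq.mp (hid i)]; rfl
    · exact Fin.cases h0 hs i

theorem exists_desc {w : Mono n} (hw : w ≠ 1) : ∃ (c d : Fin n) (i : ℤ),
    d.val = c.val + 1 ∧ (c.val = 0 ∨ i = 0) ∧ Desc w c d i := by
  by_contra h
  exact hw (eq_one_of_forall_not_desc w fun c d i hd hi hdesc => h ⟨c, d, i, hd, hi, hdesc⟩)

theorem leng_prod_le (l : List (Mono n)) (hl : ∀ g ∈ l, g ∈ gens n) :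
    leng l.prod ≤ l.length := by
  induction l using List.reverseRecOn with
  | nil => simp [leng_one]
  | append_singleton l g ih =>
    obtain ⟨c, d, i, hd, hi, rfl⟩ := hl g (by simp)
    have h := ih fun g hg => hl g (by simp [hg])
    have h' := leng_mul_gen l.prod hd hi
    simp only [List.prod_append, List.prod_cons, List.prod_nil, mul_one, List.length_append,
      List.length_cons, List.length_nil]
    omega

theorem exists_word (w : Mono n) :
    ∃ l : List (Mono n), (∀ g ∈ l, g ∈ gens n) ∧ l.prod = w ∧ l.length = leng w := by
  induction hm : leng w generalizing w with
  | zero =>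
    refine ⟨[], by simp, ?_, rfl⟩
    by_contra hw
    obtain ⟨c, d, i, hd, hi, h⟩ := exists_desc (Ne.symm hw)
    rcases leng_mul_gen w hd hi with h' | h'
    · omega
    · exact h'.1 h
  | succ m ih =>
    have hw : w ≠ 1 := by rintro rfl; simp [leng_one] at hm
    obtain ⟨c, d, i, hd, hi, h⟩ := exists_desc hw
    have hlen : leng (w * gen c d i) = m := by
      rcases leng_mul_gen w hd hi with h' | h'
      · omega
      · exact absurd h h'.1
    obtain ⟨l, hl, hprod, hlen⟩ := ih _ hlen
    refine ⟨l ++ [gen c d i], ?_, ?_, by simp [hlen]⟩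
    · intro g hg
      rcases List.mem_append.mp hg with hg | hg
      · exact hl g hg
      · exact ⟨c, d, i, hd, hi, by simpa using hg⟩
    · simp [hprod, mul_assoc, gen_mul_self]

theorem leng_mul_le (u v : Mono n) : leng (u * v) ≤ leng u + leng v := by
  obtain ⟨l, hl, rfl, hl'⟩ := exists_word u
  obtain ⟨m, hm, rfl, hm'⟩ := exists_word v
  rw [← hl', ← hm', ← List.length_append, ← List.prod_append]
  refine leng_prod_le _ fun g hg => ?_
  rcases List.mem_append.mp hg with hg | hg
  exacts [hl g hg, hm g hg]

theorem gen_inv (c d : Fin n) (i : ℤ) : (gen c d i)⁻¹ = gen c d i :=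
  inv_eq_of_mul_eq_one_left (gen_mul_self c d i)

theorem leng_inv (w : Mono n) : leng w⁻¹ = leng w := by
  have key : ∀ w : Mono n, leng w⁻¹ ≤ leng w := by
    intro w
    obtain ⟨l, hl, rfl, hl'⟩ := exists_word w
    have hmap : l.map (fun g => g⁻¹) = l := by
      rw [List.map_congr_left (g := id), List.map_id]
      intro g hg
      obtain ⟨c, d, i, -, -, rfl⟩ := hl g hg
      exact gen_inv c d i
    rw [← hl', List.prod_inv_reverse, hmap, ← List.length_reverse]
    exact leng_prod_le _ fun g hg => hl g (by simpa using hg)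
  exact le_antisymm (key w) (by simpa using key w⁻¹)

theorem eq_one_of_leng_eq_zero {w : Mono n} (hw : leng w = 0) : w = 1 := by
  obtain ⟨l, -, rfl, hl⟩ := exists_word w
  rw [hw, List.length_eq_zero_iff] at hl
  simp [hl]

theorem leng_gen {c d : Fin n} {i : ℤ} (hd : d.val = c.val + 1) (hi : c.val = 0 ∨ i = 0) :
    leng (gen c d i) = 1 := by
  have := leng_mul_gen 1 hd hi
  rw [one_mul, leng_one] at this
  omega

theorem prefixLE_gen_iff {c d : Fin n} {i : ℤ} (hd : d.val = c.val + 1) (hi : c.val = 0 ∨ i = 0)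
    (y : Mono n) : PrefixLE leng (gen c d i) y ↔ Desc y⁻¹ c d i := by
  have h := leng_mul_gen y⁻¹ hd hi
  have h' : leng ((gen c d i)⁻¹ * y) = leng (y⁻¹ * gen c d i) := by
    rw [← leng_inv]; simp
  rw [PrefixLE, h', leng_gen hd hi, ← leng_inv y]
  by_cases hD : Desc y⁻¹ c d i <;>
    simp only [hD, true_and, false_and, not_true, not_false_eq_true, or_false, false_or,
      iff_true, iff_false] at h ⊢ <;> omega

theorem exists_gen_prefixLE {w : Mono n} (hw : w ≠ 1) :
    ∃ g ∈ gens n, leng g = 1 ∧ PrefixLE leng g w := by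
  obtain ⟨c, d, i, hd, hi, h⟩ := exists_desc (inv_ne_one.mpr hw)
  exact ⟨gen c d i, ⟨c, d, i, hd, hi, rfl⟩, leng_gen hd hi, (prefixLE_gen_iff hd hi w).mpr h⟩

/-- The elements whose nonzero entries other than `1` and `x ^ k` have no nonzero entry strictly
above and to the left. -/
def Bounded (w : Mono n) (k : ℤ) : Prop :=
  ∀ j i, j < i → w.perm j < w.perm i → w.exp i = 0 ∨ w.exp i = k

theorem Bounded.inv {w : Mono n} {k : ℤ} (h : Bounded w k) : Bounded w⁻¹ (-k) := by
  intro j i hji hlt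
  have := h _ _ hlt (by simpa using hji)
  simpa using this

/-- The `k`-th power of `λ`. -/
def lamPow (n : ℕ) (k : ℤ) : Mono n :=
  ⟨1, fun i => if i.val = 0 then -((n : ℤ) - 1) * k else k, by
    cases n with
    | zero => simp
    | succ n => simp [Fin.sum_univ_succ]⟩

@[simp] theorem lamPow_perm (k : ℤ) : (lamPow n k).perm = 1 := rfl
@[simp] theorem lamPow_exp (k : ℤ) (i : Fin n) :
    (lamPow n k).exp i = if i.val = 0 then -((n : ℤ) - 1) * k else k := rfl

theorem lamPow_add (k l : ℤ) : lamPow n (k + l) = lamPow n k * lamPow n l := by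
  ext i
  · simp
  · simp only [lamPow_exp, lamPow_perm, mul_exp, Equiv.Perm.one_apply]
    split_ifs <;> ring

theorem lamPow_inv (k : ℤ) : (lamPow n k)⁻¹ = lamPow n (-k) := by
  refine inv_eq_of_mul_eq_one_left ?_
  rw [← lamPow_add]
  ext i <;> simp [lamPow]

theorem entryVal_add_entryVal {P Q : Fin n} (hne : P ≠ Q) (e : ℤ) {k : ℤ} (hk : k ≠ 0) :
    2 ≤ entryVal P Q e + entryVal P Q (-k + e) ∧
      (2 = entryVal P Q e + entryVal P Q (-k + e) ↔ (P < Q → e = 0 ∨ e = k)) := by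
  unfold entryVal
  rcases lt_or_gt_of_ne hne with h | h <;> simp only [h, h.asymm, if_true, if_false] <;>
    split_ifs <;> simp <;> omega

theorem leng_add_leng_lamPow_mul_iff (w : Mono n) {k : ℤ} (hk : k ≠ 0) :
    leng w + leng (lamPow n (-k) * w) = leng (lamPow n k) ↔ Bounded w k := by
  have hlt : ∀ x ∈ rowPairs n, x.1 < x.2 := fun x hx => by simpa [rowPairs] using hx
  have hpos : ∀ x ∈ rowPairs n, ∀ l, (lamPow n l).exp x.2 = l := fun x hx l => by
    have := Fin.lt_def.mp (hlt x hx)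
    exact if_neg (by omega)
  have hval : ∀ x ∈ rowPairs n, (lamPow n k).pairVal x.1 x.2 = 2 := fun x hx => by
    rw [pairVal, hpos x hx, entryVal, if_neg hk]
    exact if_pos (hlt x hx)
  have hmul : ∀ x ∈ rowPairs n, w.pairVal x.1 x.2 + (lamPow n (-k) * w).pairVal x.1 x.2 =
      entryVal (w.perm x.1) (w.perm x.2) (w.exp x.2) +
        entryVal (w.perm x.1) (w.perm x.2) (-k + w.exp x.2) := fun x hx => by
    simp only [pairVal, mul_perm, mul_exp, lamPow_perm, mul_one, hpos x hx,
      Equiv.Perm.one_apply]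
  have hne : ∀ x ∈ rowPairs n, w.perm x.1 ≠ w.perm x.2 := fun x hx h =>
    (hlt x hx).ne (w.perm.injective h)
  unfold leng
  rw [← Finset.sum_add_distrib, eq_comm, Finset.sum_eq_sum_iff_of_le fun x hx => by
    rw [hval x hx, hmul x hx]; exact (entryVal_add_entryVal (hne x hx) _ hk).1]
  constructor
  · intro h j i hji
    have hx : (j, i) ∈ rowPairs n := by simpa [rowPairs] using hji
    have := h _ hx
    rw [hval _ hx, hmul _ hx] at this
    exact (entryVal_add_entryVal (hne _ hx) _ hk).2.mp this
  · intro h x hx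
    rw [hval x hx, hmul x hx]
    exact (entryVal_add_entryVal (hne x hx) _ hk).2.mpr (h _ _ (hlt x hx))

theorem prefixLE_lamPow_iff (w : Mono n) {k : ℤ} (hk : k ≠ 0) :
    PrefixLE leng w (lamPow n k) ↔ Bounded w k := by
  rw [← leng_add_leng_lamPow_mul_iff w hk, PrefixLE, ← leng_inv (w⁻¹ * lamPow n k)]
  simp [lamPow_inv]

theorem prefixLE_inv_mul_lamPow {w : Mono n} {k : ℤ} (hk : k ≠ 0)
    (hw : PrefixLE leng w (lamPow n k)) : PrefixLE leng (w⁻¹ * lamPow n k) (lamPow n k) := by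
  have h : Bounded (w⁻¹ * lamPow n k)⁻¹ (-k) := by
    rw [← leng_add_leng_lamPow_mul_iff _ (neg_ne_zero.mpr hk), leng_inv, neg_neg, ← lamPow_inv,
      leng_inv, mul_inv_rev, inv_inv, mul_inv_cancel_left, add_comm]
    exact hw
  rw [prefixLE_lamPow_iff _ hk]
  simpa using h.inv

theorem mul_gen_symm (w : Mono n) (c d : Fin n) (i : ℤ) (x : Fin n) :
    (w * gen c d i).perm.symm x = w.perm.symm (Equiv.swap c d x) := rfl

theorem gen_mul_gen_comm {c d c' d' : Fin n} (i i' : ℤ) (h₁ : c ≠ c') (h₂ : c ≠ d') (h₃ : d ≠ c')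
    (h₄ : d ≠ d') : gen c d i * gen c' d' i' = gen c' d' i' * gen c d i := by
  ext r
  · simp only [mul_perm, gen_perm, Equiv.Perm.mul_apply, Equiv.swap_apply_def]
    grind
  · simp only [mul_exp, gen_perm, gen_exp, Equiv.swap_apply_def]
    grind

theorem gen_braid {c d e : Fin n} (i : ℤ) (h₁ : c ≠ d) (h₂ : c ≠ e) (h₃ : d ≠ e) :
    gen c d i * (gen d e 0 * gen c d i) = gen d e 0 * (gen c d i * gen d e 0) := by
  ext r
  · simp only [mul_perm, gen_perm, Equiv.Perm.mul_apply, Equiv.swap_apply_def]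
    grind
  · simp only [mul_exp, gen_perm, gen_exp, Equiv.swap_apply_def]
    grind

theorem gen_mul_gen_sub {c d : Fin n} (i j k : ℤ) (h : c ≠ d) :
    gen c d i * gen c d (i - k) = gen c d j * gen c d (j - k) := by
  ext r
  · simp
  · simp only [mul_exp, gen_perm, gen_exp, Equiv.swap_apply_def]
    grind

theorem Desc.leng_mul {w : Mono n} {c d : Fin n} {i : ℤ} (h : Desc w c d i)
    (hd : d.val = c.val + 1) (hi : c.val = 0 ∨ i = 0) : leng (w * gen c d i) + 1 = leng w := by
  have := leng_mul_gen w hd hi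
  simpa [h] using this

theorem Desc.mul_gen_of_disjoint {w : Mono n} {c d c' d' : Fin n} {i i' : ℤ}
    (h : Desc w c' d' i') (h₁ : c ≠ c') (h₂ : c ≠ d') (h₃ : d ≠ c') (h₄ : d ≠ d') :
    Desc (w * gen c d i) c' d' i' := by
  simpa [Desc, mul_gen_symm, -mul_perm, Equiv.swap_apply_of_ne_of_ne, h₁.symm, h₂.symm, h₃.symm, h₄.symm]
    using h

theorem Desc.mul_gen_of_adjacent {w : Mono n} {c d e : Fin n} {i : ℤ}
    (h : Desc w c d i) (h' : Desc w d e 0) (h₁ : c ≠ d) (h₂ : c ≠ e) (h₃ : d ≠ e) :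
    Desc (w * gen c d i) d e 0 ∧ Desc (w * gen c d i * gen d e 0) c d i := by
  have hc : w.perm (w.perm.symm c) = c := w.perm.apply_symm_apply c
  have hd : w.perm (w.perm.symm d) = d := w.perm.apply_symm_apply d
  have he : w.perm (w.perm.symm e) = e := w.perm.apply_symm_apply e
  simp only [Desc, mul_gen_symm, mul_exp, gen_exp, Equiv.swap_apply_of_ne_of_ne h₁ h₂,
    Equiv.swap_apply_of_ne_of_ne h₂.symm h₃.symm, Equiv.swap_apply_left,
    Equiv.swap_apply_right, hc, hd, he, h₁, h₁.symm, h₂.symm, h₃.symm] at h h' ⊢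
  simp only [ite_true, ite_false, ite_self]
  grind

theorem Desc.mul_gen_of_bounded {w : Mono n} {c d : Fin n} {i j k : ℤ} (h : Desc w c d i)
    (h' : Desc w c d j) (hij : i ≠ j) (hcd : c < d) (hw : Bounded w (-k)) :
    Desc (w * gen c d i) c d (i - k) := by
  have hc : w.perm (w.perm.symm c) = c := w.perm.apply_symm_apply c
  have hd : w.perm (w.perm.symm d) = d := w.perm.apply_symm_apply d
  have hb := hw (w.perm.symm c) (w.perm.symm d)
  rw [hc, hd] at hb
  simp only [Desc, mul_gen_symm, mul_exp, gen_exp, Equiv.swap_apply_left,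
    Equiv.swap_apply_right, hc, hd, hcd.ne, hcd.ne'] at h h' ⊢
  grind

theorem prefixLE_of_leng_mul {y m g g' h h' : Mono n} {l : ℕ} (hg : leng g ≤ 1) (hh : leng h ≤ 1)
    (hg' : leng g' ≤ l) (hh' : leng h' ≤ l) (hmg : m = g * g') (hmh : m = h * h')
    (hy : leng (y⁻¹ * m) + (l + 1) = leng y⁻¹) :
    PrefixLE leng g m ∧ PrefixLE leng h m ∧ PrefixLE leng m y := by
  have h₁ := leng_mul_le (y⁻¹ * m) m⁻¹
  rw [mul_inv_cancel_right, leng_inv m] at h₁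
  have h₂ := leng_mul_le g g'
  have h₃ := leng_mul_le h h'
  rw [← hmg] at h₂
  rw [← hmh] at h₃
  have h₄ : leng (m⁻¹ * y) = leng (y⁻¹ * m) := by rw [← leng_inv]; simp
  have h₅ := leng_inv y
  refine ⟨?_, ?_, ?_⟩ <;> unfold PrefixLE
  · rw [hmg, inv_mul_cancel_left, ← hmg]; omega
  · rw [hmh, inv_mul_cancel_left, ← hmh]; omega
  · omega

theorem exists_lcm_of_lt {c d c' d' : Fin n} {i i' : ℤ}
    (hd : d.val = c.val + 1) (hi : c.val = 0 ∨ i = 0) (hd' : d'.val = c'.val + 1)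
    (hi' : c'.val = 0 ∨ i' = 0) (hlt : c.val < c'.val) :
    ∃ m, ∀ y, PrefixLE leng (gen c d i) y → PrefixLE leng (gen c' d' i') y →
      PrefixLE leng (gen c d i) m ∧ PrefixLE leng (gen c' d' i') m ∧ PrefixLE leng m y := by
  have hg := leng_gen hd hi
  have hg' := leng_gen hd' hi'
  by_cases hdc : d = c'
  · subst hdc
    obtain rfl : i' = 0 := by omega
    have h₁ : c ≠ d := by rintro rfl; omega
    have h₂ : c ≠ d' := by rintro rfl; omega
    have h₃ : d ≠ d' := by rintro rfl; omega
    refine ⟨gen c d i * (gen d d' 0 * gen c d i), fun y hy hy' => ?_⟩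
    rw [prefixLE_gen_iff hd hi] at hy
    rw [prefixLE_gen_iff hd' hi'] at hy'
    obtain ⟨hD, hD'⟩ := hy.mul_gen_of_adjacent hy' h₁ h₂ h₃
    have e₁ := hy.leng_mul hd hi
    have e₂ := hD.leng_mul hd' hi'
    have e₃ := hD'.leng_mul hd hi
    have f₁ := leng_mul_le (gen d d' 0) (gen c d i)
    have f₂ := leng_mul_le (gen c d i) (gen d d' 0)
    refine prefixLE_of_leng_mul (l := 2) hg.le hg'.le (by omega) (by omega) rfl
      (gen_braid i h₁ h₂ h₃) ?_
    rw [← mul_assoc, ← mul_assoc]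
    omega
  · have hdc' : d.val ≠ c'.val := fun h => hdc (Fin.ext h)
    have h₁ : c ≠ c' := by rintro rfl; omega
    have h₂ : c ≠ d' := by rintro rfl; omega
    have h₄ : d ≠ d' := by rintro rfl; omega
    refine ⟨gen c d i * gen c' d' i', fun y hy hy' => ?_⟩
    rw [prefixLE_gen_iff hd hi] at hy
    rw [prefixLE_gen_iff hd' hi'] at hy'
    have e₁ := hy.leng_mul hd hi
    have e₂ := (hy'.mul_gen_of_disjoint (i := i) h₁ h₂ hdc h₄).leng_mul hd' hi'
    refine prefixLE_of_leng_mul (l := 1) hg.le hg'.le hg'.le hg.le rfl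
      (gen_mul_gen_comm i i' h₁ h₂ hdc h₄) ?_
    rw [← mul_assoc]
    omega

theorem exists_lcm {k : ℤ} (hk : k ≠ 0) {g h : Mono n} (hgS : g ∈ gens n) (hhS : h ∈ gens n) :
    ∃ m, ∀ y, PrefixLE leng y (lamPow n k) → PrefixLE leng g y → PrefixLE leng h y →
      PrefixLE leng g m ∧ PrefixLE leng h m ∧ PrefixLE leng m y := by
  obtain ⟨c, d, i, hd, hi, rfl⟩ := hgS
  obtain ⟨c', d', i', hd', hi', rfl⟩ := hhS
  rcases lt_trichotomy c.val c'.val with hlt | heq | hlt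
  · obtain ⟨m, hm⟩ := exists_lcm_of_lt hd hi hd' hi' hlt
    exact ⟨m, fun y _ => hm y⟩
  · obtain rfl := Fin.ext heq
    obtain rfl : d = d' := Fin.ext (by omega)
    have hcd : c < d := by rw [Fin.lt_def]; omega
    by_cases hii : i = i'
    · subst hii
      have hr : PrefixLE leng (gen c d i) (gen c d i) := by simp [PrefixLE, leng_one]
      exact ⟨gen c d i, fun y _ hy _ => ⟨hr, hr, hy⟩⟩
    have hc : c.val = 0 := by omega
    refine ⟨gen c d i * gen c d (i - k), fun y hyk hy hy' => ?_⟩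
    have hb := ((prefixLE_lamPow_iff y hk).mp hyk).inv
    rw [prefixLE_gen_iff hd hi] at hy
    rw [prefixLE_gen_iff hd hi'] at hy'
    have e₁ := hy.leng_mul hd hi
    have e₂ := (hy.mul_gen_of_bounded hy' hii hcd hb).leng_mul hd (.inl hc)
    refine prefixLE_of_leng_mul (l := 1) (leng_gen hd hi).le (leng_gen hd hi').le
      (leng_gen hd (.inl hc)).le (leng_gen hd (.inl hc)).le rfl
      (gen_mul_gen_sub i i' k hcd.ne) ?_
    rw [← mul_assoc]
    omega
  · obtain ⟨m, hm⟩ := exists_lcm_of_lt hd' hi' hd hi hlt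
    refine ⟨m, fun y _ hy hy' => ?_⟩
    obtain ⟨h₁, h₂, h₃⟩ := hm y hy' hy
    exact ⟨h₂, h₁, h₃⟩

theorem exists_join {k : ℤ} (hk : k ≠ 0) {a b : Mono n} (ha : PrefixLE leng a (lamPow n k))
    (hb : PrefixLE leng b (lamPow n k)) :
    ∃ m, PrefixLE leng m (lamPow n k) ∧ PrefixLE leng a m ∧ PrefixLE leng b m ∧
      ∀ w, PrefixLE leng w (lamPow n k) → PrefixLE leng a w → PrefixLE leng b w →
        PrefixLE leng m w :=
  PrefixLE.exists_join leng_mul_le leng_one (fun _ => exists_gen_prefixLE)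
    (fun _ => prefixLE_inv_mul_lamPow hk) (fun _ hg _ hh => exists_lcm hk hg hh) ha hb

theorem exists_meet {k : ℤ} (hk : k ≠ 0) {a b : Mono n} (ha : PrefixLE leng a (lamPow n k))
    (hb : PrefixLE leng b (lamPow n k)) :
    ∃ m, PrefixLE leng m (lamPow n k) ∧ PrefixLE leng m a ∧ PrefixLE leng m b ∧
      ∀ w, PrefixLE leng w (lamPow n k) → PrefixLE leng w a → PrefixLE leng w b →
        PrefixLE leng w m :=
  PrefixLE.exists_meet leng_mul_le leng_one (fun _ => eq_one_of_leng_eq_zero)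
    (fun _ _ => exists_join hk) ha hb

end Mono

theorem xx_ne_zero : xx ≠ 0 := RatFunc.X_ne_zero

theorem xx_zpow_injective : Function.Injective fun k : ℤ => xx ^ k := by
  have hpow : ∀ m : ℕ, xx ^ m = 1 → m = 0 := by
    intro m hm
    have h : (algebraMap (Polynomial ℚ) (RatFunc ℚ)) (Polynomial.X ^ m) =
        algebraMap (Polynomial ℚ) (RatFunc ℚ) 1 := by
      rw [map_pow, RatFunc.algebraMap_X, map_one]
      exact hm
    simpa using congrArg Polynomial.natDegree (RatFunc.algebraMap_injective ℚ h)
  have hone : ∀ k : ℤ, xx ^ k = 1 → k = 0 := by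
    intro k hk
    obtain ⟨m, rfl | rfl⟩ := k.eq_nat_or_neg
    · rw [zpow_natCast] at hk
      simp [hpow m hk]
    · rw [zpow_neg, zpow_natCast, inv_eq_one] at hk
      simp [hpow m hk]
  intro k l hkl
  have := hone (k - l) (by
    rw [zpow_sub₀ xx_ne_zero]
    exact (div_eq_one_iff_eq (zpow_ne_zero _ xx_ne_zero)).mpr hkl)
  omega

namespace Mono

variable {n : ℕ}

/-- The monomial matrix of an element of `G(∞,∞,n)`. -/
noncomputable def toMat : Mono n →* Matrix (Fin n) (Fin n) (RatFunc ℚ) where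
  toFun w := Matrix.of fun i c => if w.perm i = c then xx ^ w.exp i else 0
  map_one' := by
    ext i c
    simp [Matrix.one_apply]
  map_mul' w v := by
    ext i c
    rw [Matrix.mul_apply, Finset.sum_eq_single (w.perm i)]
    · simp [zpow_add₀ xx_ne_zero]
    · intro j _ hj
      simp [hj.symm]
    · simp

theorem toMat_apply (w : Mono n) (i c : Fin n) :
    toMat w i c = if w.perm i = c then xx ^ w.exp i else 0 := rfl

theorem toMat_injective : Function.Injective (toMat : Mono n → _) := by
  intro w v h
  have key : ∀ i, v.perm i = w.perm i ∧ xx ^ w.exp i = xx ^ v.exp i := by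
    intro i
    have := congrFun (congrFun h i) (w.perm i)
    rw [toMat_apply, toMat_apply, if_pos rfl] at this
    by_cases hp : v.perm i = w.perm i
    · exact ⟨hp, by rwa [if_pos hp] at this⟩
    · rw [if_neg hp] at this
      exact absurd this (zpow_ne_zero _ xx_ne_zero)
  ext i
  · rw [(key i).1]
  · exact xx_zpow_injective (key i).2

theorem toMat_inv (w : Mono n) : toMat w⁻¹ = (toMat w)⁻¹ :=
  (Matrix.inv_eq_right_inv (by rw [← map_mul, mul_inv_cancel, map_one])).symm

theorem toMat_gen_zero_one (hn : 2 ≤ n) (i : ℤ) :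
    toMat (gen ⟨0, by omega⟩ ⟨1, by omega⟩ i) = tMat n i := by
  ext r c
  simp only [toMat_apply, gen_perm, gen_exp, tMat, Equiv.swap_apply_def]
  simp only [Fin.ext_iff]
  split_ifs <;> simp_all <;> omega

theorem toMat_gen_zero {c d : Fin n} {j : ℕ} (hc : c.val + 2 = j) (hd : d.val + 1 = j) :
    toMat (gen c d 0) = sMat n j := by
  ext r s
  simp only [toMat_apply, gen_perm, gen_exp, sMat, Equiv.swap_apply_def]
  simp only [Fin.ext_iff]
  split_ifs <;> simp_all <;> omega

theorem mem_Xset_iff (hn : 2 ≤ n) (a : Matrix (Fin n) (Fin n) (RatFunc ℚ)) :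
    a ∈ Xset n ↔ ∃ g ∈ gens n, toMat g = a := by
  constructor
  · rintro (⟨i, rfl⟩ | ⟨j, hj, hjn, rfl⟩)
    · exact ⟨_, ⟨_, _, i, rfl, .inl rfl, rfl⟩, toMat_gen_zero_one hn i⟩
    · exact ⟨_, ⟨⟨j - 2, by omega⟩, ⟨j - 1, by omega⟩, 0, by simp; omega, .inr rfl, rfl⟩,
        toMat_gen_zero (by simp; omega) (by simp; omega)⟩
  · rintro ⟨_, ⟨c, d, i, hd, hi, rfl⟩, rfl⟩
    by_cases hc : c.val = 0
    · obtain rfl : c = ⟨0, Nat.zero_lt_of_lt hn⟩ := Fin.ext hc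
      obtain rfl : d = ⟨1, hn⟩ := Fin.ext hd
      exact .inl ⟨i, toMat_gen_zero_one hn i⟩
    · obtain rfl : i = 0 := by omega
      exact .inr ⟨c.val + 2, by omega, by omega, toMat_gen_zero rfl (by omega)⟩

theorem exists_map_toMat (hn : 2 ≤ n) (L : List (Matrix (Fin n) (Fin n) (RatFunc ℚ)))
    (hL : ∀ a ∈ L, a ∈ Xset n) :
    ∃ l : List (Mono n), (∀ g ∈ l, g ∈ gens n) ∧ l.map toMat = L := by
  induction L with
  | nil => exact ⟨[], by simp, rfl⟩
  | cons a L ih =>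
    obtain ⟨l, hl, rfl⟩ := ih fun b hb => hL b (List.mem_cons_of_mem _ hb)
    obtain ⟨g, hg, rfl⟩ := (mem_Xset_iff hn a).mp (hL a List.mem_cons_self)
    exact ⟨g :: l, by simpa using ⟨hg, hl⟩, rfl⟩

theorem len_toMat (hn : 2 ≤ n) (w : Mono n) : len n (toMat w) = leng w := by
  have hw : leng w ∈ {m | ∃ L : List (Matrix (Fin n) (Fin n) (RatFunc ℚ)),
      L.length = m ∧ (∀ a ∈ L, a ∈ Xset n) ∧ L.prod = toMat w} := by
    obtain ⟨l, hl, rfl, hlen⟩ := exists_word w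
    refine ⟨l.map toMat, by simp [hlen], ?_, (map_list_prod toMat l).symm⟩
    intro a ha
    obtain ⟨g, hg, rfl⟩ := List.mem_map.mp ha
    exact (mem_Xset_iff hn _).mpr ⟨g, hl g hg, rfl⟩
  refine le_antisymm (Nat.sInf_le hw) (le_csInf ⟨_, hw⟩ ?_)
  rintro m ⟨L, rfl, hL, hprod⟩
  obtain ⟨l, hl, rfl⟩ := exists_map_toMat hn L hL
  rw [← map_list_prod] at hprod
  rw [← toMat_injective hprod, List.length_map]
  exact leng_prod_le l hl

theorem len_eq_zero_of_notMem_range (hn : 2 ≤ n) {a : Matrix (Fin n) (Fin n) (RatFunc ℚ)}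
    (ha : ∀ w : Mono n, toMat w ≠ a) : len n a = 0 := by
  refine Nat.sInf_eq_zero.mpr (.inr (Set.eq_empty_iff_forall_notMem.mpr ?_))
  rintro m ⟨L, rfl, hL, rfl⟩
  obtain ⟨l, hl, rfl⟩ := exists_map_toMat hn L hL
  exact ha l.prod (map_list_prod toMat l)

theorem toMat_lamPow (k : ℤ) : toMat (lamPow n k) = lam n ^ k := by
  have hlam : toMat (lamPow n 1) = lam n := by
    ext i c
    simp only [toMat_apply, lamPow_perm, lamPow_exp, lam, Matrix.diagonal_apply,
      Equiv.Perm.one_apply]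
    split_ifs <;> simp_all
  have hpow : lamPow n 1 ^ k = lamPow n k := by
    induction k with
    | zero => ext i <;> simp
    | succ k ih => rw [zpow_add_one, ih, ← lamPow_add]
    | pred k ih => rw [zpow_sub_one, ih, lamPow_inv, ← lamPow_add]; rfl
  rw [← hpow, ← hlam]
  exact map_zpow' toMat toMat_inv _ _

theorem leng_lamPow_ne_zero (hn : 2 ≤ n) {k : ℤ} (hk : k ≠ 0) : leng (lamPow n k) ≠ 0 := by
  intro h
  have h₁ := congrArg (fun w => Mono.exp w ⟨1, by omega⟩) (eq_one_of_leng_eq_zero h)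
  simp [hk] at h₁

theorem preL_toMat_iff (hn : 2 ≤ n) (v w : Mono n) :
    preL n (toMat v) (toMat w) ↔ PrefixLE leng v w := by
  rw [preL, PrefixLE, ← toMat_inv, ← map_mul, len_toMat hn, len_toMat hn, len_toMat hn]

theorem preR_toMat_iff (hn : 2 ≤ n) (v w : Mono n) :
    preR n (toMat v) (toMat w) ↔ PrefixLE leng v⁻¹ w⁻¹ := by
  rw [preR, PrefixLE, ← toMat_inv, ← map_mul, len_toMat hn, len_toMat hn, len_toMat hn,
    leng_inv, leng_inv, ← leng_inv (w * v⁻¹), mul_inv_rev, add_comm]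

theorem toMat_inv_eq_of_eq_inv {a : Matrix (Fin n) (Fin n) (RatFunc ℚ)} {w : Mono n}
    (h : toMat w = a⁻¹) : toMat w⁻¹ = a := by
  have hdet : IsUnit (toMat w).det :=
    (Matrix.isUnit_iff_isUnit_det _).mp (IsUnit.map toMat (Group.isUnit w))
  rw [toMat_inv, h, Matrix.nonsing_inv_nonsing_inv]
  rw [h] at hdet
  exact (Matrix.isUnit_nonsing_inv_det_iff).mp hdet

theorem exists_of_mem_intervalL (hn : 2 ≤ n) {k : ℤ} (hk : k ≠ 0)
    {a : Matrix (Fin n) (Fin n) (RatFunc ℚ)} (ha : a ∈ intervalL n k) :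
    ∃ w : Mono n, PrefixLE leng w (lamPow n k) ∧ toMat w = a := by
  by_cases h : ∃ w : Mono n, toMat w = a
  · obtain ⟨w, rfl⟩ := h
    refine ⟨w, (preL_toMat_iff hn _ _).mp ?_, rfl⟩
    rw [toMat_lamPow]
    exact ha
  · push Not at h
    have h₀ : preL n a (toMat (lamPow n k)) := by rw [toMat_lamPow]; exact ha
    have h₁ : ∀ v : Mono n, toMat v ≠ a⁻¹ * toMat (lamPow n k) := by
      intro v hv
      refine h _ (toMat_inv_eq_of_eq_inv (w := v * (lamPow n k)⁻¹) ?_)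
      rw [map_mul, hv, mul_assoc, ← map_mul, mul_inv_cancel, map_one, mul_one]
    rw [preL, len_eq_zero_of_notMem_range hn h, len_eq_zero_of_notMem_range hn h₁,
      len_toMat hn] at h₀
    exact absurd h₀.symm (leng_lamPow_ne_zero hn hk)

theorem exists_of_mem_intervalR (hn : 2 ≤ n) {k : ℤ} (hk : k ≠ 0)
    {a : Matrix (Fin n) (Fin n) (RatFunc ℚ)} (ha : a ∈ intervalR n k) :
    ∃ w : Mono n, PrefixLE leng w (lamPow n (-k)) ∧ toMat w⁻¹ = a := by
  by_cases h : ∃ w : Mono n, toMat w = a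
  · obtain ⟨w, rfl⟩ := h
    refine ⟨w⁻¹, ?_, by rw [inv_inv]⟩
    rw [← lamPow_inv, ← preR_toMat_iff hn, toMat_lamPow]
    exact ha
  · push Not at h
    have h₀ : preR n a (toMat (lamPow n k)) := by rw [toMat_lamPow]; exact ha
    have h₁ : ∀ v : Mono n, toMat v ≠ toMat (lamPow n k) * a⁻¹ := by
      intro v hv
      refine h _ (toMat_inv_eq_of_eq_inv (w := (lamPow n k)⁻¹ * v) ?_)
      rw [map_mul, hv, ← mul_assoc, ← map_mul, inv_mul_cancel, map_one, one_mul]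
    rw [preR, len_eq_zero_of_notMem_range hn h, len_eq_zero_of_notMem_range hn h₁,
      len_toMat hn] at h₀
    exact absurd h₀.symm (leng_lamPow_ne_zero hn hk)

theorem toMat_mem_intervalL (hn : 2 ≤ n) {k : ℤ} {w : Mono n}
    (hw : PrefixLE leng w (lamPow n k)) : toMat w ∈ intervalL n k := by
  have := (preL_toMat_iff hn _ _).mpr hw
  rwa [toMat_lamPow] at this

theorem toMat_inv_mem_intervalR (hn : 2 ≤ n) {k : ℤ} {w : Mono n}
    (hw : PrefixLE leng w (lamPow n (-k))) : toMat w⁻¹ ∈ intervalR n k := by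
  rw [← lamPow_inv, ← inv_inv w, ← preR_toMat_iff hn, toMat_lamPow] at hw
  exact hw

theorem preR_toMat_inv_iff (hn : 2 ≤ n) (v w : Mono n) :
    preR n (toMat v⁻¹) (toMat w⁻¹) ↔ PrefixLE leng v w := by
  rw [preR_toMat_iff hn, inv_inv, inv_inv]

end Mono

/-- both posets `([1,λ^k], ⪯)` and `([1,λ^k]_r, ⪯_r)` are lattices. -/
theorem stmt_8 (n : ℕ) (hn : 2 ≤ n) (k : ℤ) (hk : k ≠ 0) :
    (∀ a ∈ intervalL n k, ∀ b ∈ intervalL n k,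
      (∃ m ∈ intervalL n k, preL n a m ∧ preL n b m ∧
        ∀ z ∈ intervalL n k, preL n a z → preL n b z → preL n m z) ∧
      (∃ g ∈ intervalL n k, preL n g a ∧ preL n g b ∧
        ∀ z ∈ intervalL n k, preL n z a → preL n z b → preL n z g)) ∧
    (∀ a ∈ intervalR n k, ∀ b ∈ intervalR n k,
      (∃ m ∈ intervalR n k, preR n a m ∧ preR n b m ∧
        ∀ z ∈ intervalR n k, preR n a z → preR n b z → preR n m z) ∧
      (∃ g ∈ intervalR n k, preR n g a ∧ preR n g b ∧
        ∀ z ∈ intervalR n k, preR n z a → preR n z b → preR n z g)) := by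
  constructor
  · intro a ha b hb
    obtain ⟨u, hu, rfl⟩ := Mono.exists_of_mem_intervalL hn hk ha
    obtain ⟨v, hv, rfl⟩ := Mono.exists_of_mem_intervalL hn hk hb
    obtain ⟨m, hm, hum, hvm, hmin⟩ := Mono.exists_join hk hu hv
    obtain ⟨g, hg, hgu, hgv, hmax⟩ := Mono.exists_meet hk hu hv
    refine ⟨⟨m.toMat, Mono.toMat_mem_intervalL hn hm, (Mono.preL_toMat_iff hn _ _).mpr hum,
      (Mono.preL_toMat_iff hn _ _).mpr hvm, fun z hz huz hvz => ?_⟩,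
      ⟨g.toMat, Mono.toMat_mem_intervalL hn hg, (Mono.preL_toMat_iff hn _ _).mpr hgu,
      (Mono.preL_toMat_iff hn _ _).mpr hgv, fun z hz hzu hzv => ?_⟩⟩
    · obtain ⟨w, hw, rfl⟩ := Mono.exists_of_mem_intervalL hn hk hz
      rw [Mono.preL_toMat_iff hn] at huz hvz ⊢
      exact hmin w hw huz hvz
    · obtain ⟨w, hw, rfl⟩ := Mono.exists_of_mem_intervalL hn hk hz
      rw [Mono.preL_toMat_iff hn] at hzu hzv ⊢
      exact hmax w hw hzu hzv
  · intro a ha b hb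
    have hk' : -k ≠ 0 := neg_ne_zero.mpr hk
    obtain ⟨u, hu, rfl⟩ := Mono.exists_of_mem_intervalR hn hk ha
    obtain ⟨v, hv, rfl⟩ := Mono.exists_of_mem_intervalR hn hk hb
    obtain ⟨m, hm, hum, hvm, hmin⟩ := Mono.exists_join hk' hu hv
    obtain ⟨g, hg, hgu, hgv, hmax⟩ := Mono.exists_meet hk' hu hv
    refine ⟨⟨m⁻¹.toMat, Mono.toMat_inv_mem_intervalR hn hm,
      (Mono.preR_toMat_inv_iff hn _ _).mpr hum,
      (Mono.preR_toMat_inv_iff hn _ _).mpr hvm, fun z hz huz hvz => ?_⟩,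
      ⟨g⁻¹.toMat, Mono.toMat_inv_mem_intervalR hn hg, (Mono.preR_toMat_inv_iff hn _ _).mpr hgu,
      (Mono.preR_toMat_inv_iff hn _ _).mpr hgv, fun z hz hzu hzv => ?_⟩⟩
    · obtain ⟨w, hw, rfl⟩ := Mono.exists_of_mem_intervalR hn hk hz
      rw [Mono.preR_toMat_inv_iff hn] at huz hvz ⊢
      exact hmin w hw huz hvz
    · obtain ⟨w, hw, rfl⟩ := Mono.exists_of_mem_intervalR hn hk hz
      rw [Mono.preR_toMat_inv_iff hn] at hzu hzv ⊢
      exact hmax w hw hzu hzv
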